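/- arXiv:1909.05292 — 3 statements merged into one kernel-verified Lean document; each statement's English description precedes it below -/
import Mathlib

section
/- Let E be the sapphire group determined by integers r, s, t, u with ru − st = 1 and rstu ≠ 0. If φ is an automorphism of E satisfying φ(d) = d, φ(b) = b and φ(v) = v, then φ is the identity automorphism. Equivalently, the restriction map from Aut(E) to Aut(N), where N is the subgroup generated by d, b, v, is injective. -/
open Matrix SemidirectProduct Multiplicative

abbrev GL2Z := GL (Fin 2) ℤ

/-- The defining relations of the sapphire group determined by `r, s, t, u`, on the four
generators `d = 0`, `b = 1`, `v = 2`, `a = 3`. -/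
def sapphireRels (r s t u : ℤ) : Set (FreeGroup (Fin 4)) :=
  { FreeGroup.of 0 * FreeGroup.of 1 * (FreeGroup.of 0)⁻¹ * (FreeGroup.of 1)⁻¹,
    FreeGroup.of 2 * FreeGroup.of 0 * (FreeGroup.of 2)⁻¹ *
      (FreeGroup.of 0 ^ (r * u + s * t) * FreeGroup.of 1 ^ (-(2 * s * u)))⁻¹,
    FreeGroup.of 2 * FreeGroup.of 1 * (FreeGroup.of 2)⁻¹ *
      (FreeGroup.of 0 ^ (-(2 * r * t)) * FreeGroup.of 1 ^ (r * u + s * t))⁻¹,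
    FreeGroup.of 3 ^ 2 * (FreeGroup.of 0)⁻¹,
    FreeGroup.of 3 * FreeGroup.of 1 * (FreeGroup.of 3)⁻¹ * FreeGroup.of 1,
    FreeGroup.of 3 * FreeGroup.of 2 * (FreeGroup.of 3)⁻¹ *
      (FreeGroup.of 0 ^ (r - r * u - s * t) * FreeGroup.of 1 ^ (s - 2 * s * u) *
        (FreeGroup.of 2)⁻¹)⁻¹ }

/-- The sapphire group: the fundamental group of the sapphire Sol 3-manifold determined by the
matrix `[[r, s], [t, u]]`. -/
abbrev Sapphire (r s t u : ℤ) : Type := PresentedGroup (sapphireRels r s t u)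

/-- The generator `d` of the sapphire group. -/
def sapd (r s t u : ℤ) : Sapphire r s t u := PresentedGroup.of 0

/-- The generator `b` of the sapphire group. -/
def sapb (r s t u : ℤ) : Sapphire r s t u := PresentedGroup.of 1

/-- The generator `v` of the sapphire group. -/
def sapv (r s t u : ℤ) : Sapphire r s t u := PresentedGroup.of 2

/-- The generator `a` of the sapphire group. -/
def sapa (r s t u : ℤ) : Sapphire r s t u := PresentedGroup.of 3

/-- The subgroup `⟨d, b⟩` of the sapphire group. -/
def sapDB (r s t u : ℤ) : Subgroup (Sapphire r s t u) :=
  Subgroup.closure {sapd r s t u, sapb r s t u}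

section NormalForm

variable (r s t u : ℤ)

lemma sapd_mul_sapb : sapd r s t u * sapb r s t u = sapb r s t u * sapd r s t u := by
  have h : (PresentedGroup.mk (sapphireRels r s t u)) (FreeGroup.of 0 * FreeGroup.of 1 *
      (FreeGroup.of 0)⁻¹ * (FreeGroup.of 1)⁻¹) = 1 :=
    PresentedGroup.one_of_mem (by simp [sapphireRels])
  simp only [map_mul, map_inv] at h
  exact (mul_inv_eq_iff_eq_mul.mp (mul_inv_eq_one.mp h))

lemma sapv_conj_sapd : sapv r s t u * sapd r s t u * (sapv r s t u)⁻¹ =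
    sapd r s t u ^ (r * u + s * t) * sapb r s t u ^ (-(2 * s * u)) := by
  have h : (PresentedGroup.mk (sapphireRels r s t u)) (FreeGroup.of 2 * FreeGroup.of 0 *
      (FreeGroup.of 2)⁻¹ *
      (FreeGroup.of 0 ^ (r * u + s * t) * FreeGroup.of 1 ^ (-(2 * s * u)))⁻¹) = 1 :=
    PresentedGroup.one_of_mem (by simp [sapphireRels])
  simp only [map_mul, map_inv, map_zpow] at h
  exact mul_inv_eq_one.mp h

lemma sapv_conj_sapb : sapv r s t u * sapb r s t u * (sapv r s t u)⁻¹ =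
    sapd r s t u ^ (-(2 * r * t)) * sapb r s t u ^ (r * u + s * t) := by
  have h : (PresentedGroup.mk (sapphireRels r s t u)) (FreeGroup.of 2 * FreeGroup.of 1 *
      (FreeGroup.of 2)⁻¹ *
      (FreeGroup.of 0 ^ (-(2 * r * t)) * FreeGroup.of 1 ^ (r * u + s * t))⁻¹) = 1 :=
    PresentedGroup.one_of_mem (by simp [sapphireRels])
  simp only [map_mul, map_inv, map_zpow] at h
  exact mul_inv_eq_one.mp h

lemma sapa_sq : sapa r s t u ^ 2 = sapd r s t u := by
  have h : (PresentedGroup.mk (sapphireRels r s t u)) (FreeGroup.of 3 ^ 2 *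
      (FreeGroup.of 0)⁻¹) = 1 :=
    PresentedGroup.one_of_mem (by simp [sapphireRels])
  simp only [map_mul, map_inv, map_pow] at h
  exact mul_inv_eq_one.mp h

lemma sapa_conj_sapb : sapa r s t u * sapb r s t u * (sapa r s t u)⁻¹ = (sapb r s t u)⁻¹ := by
  have h : (PresentedGroup.mk (sapphireRels r s t u)) (FreeGroup.of 3 * FreeGroup.of 1 *
      (FreeGroup.of 3)⁻¹ * FreeGroup.of 1) = 1 :=
    PresentedGroup.one_of_mem (by simp [sapphireRels])
  simp only [map_mul, map_inv] at h
  exact eq_inv_of_mul_eq_one_left h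

lemma sapa_conj_sapv : sapa r s t u * sapv r s t u * (sapa r s t u)⁻¹ =
    sapd r s t u ^ (r - r * u - s * t) * sapb r s t u ^ (s - 2 * s * u) *
      (sapv r s t u)⁻¹ := by
  have h : (PresentedGroup.mk (sapphireRels r s t u)) (FreeGroup.of 3 * FreeGroup.of 2 *
      (FreeGroup.of 3)⁻¹ *
      (FreeGroup.of 0 ^ (r - r * u - s * t) * FreeGroup.of 1 ^ (s - 2 * s * u) *
        (FreeGroup.of 2)⁻¹)⁻¹) = 1 :=
    PresentedGroup.one_of_mem (by simp [sapphireRels])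
  simp only [map_mul, map_inv, map_zpow] at h
  exact mul_inv_eq_one.mp h

lemma sapphire_closure_eq_top :
    Subgroup.closure {sapd r s t u, sapb r s t u, sapv r s t u, sapa r s t u} = ⊤ := by
  rw [← PresentedGroup.closure_range_of (sapphireRels r s t u)]
  congr 1
  ext x
  simp only [Set.mem_range, Fin.exists_fin_succ, Set.mem_insert_iff, Set.mem_singleton_iff]
  simp [sapd, sapb, sapv, sapa, eq_comm]

lemma sapd_mem_sapDB : sapd r s t u ∈ sapDB r s t u :=
  Subgroup.subset_closure (by simp)

lemma sapb_mem_sapDB : sapb r s t u ∈ sapDB r s t u :=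
  Subgroup.subset_closure (by simp)

lemma mem_sapDB {r s t u : ℤ} {g : Sapphire r s t u} (hg : g ∈ sapDB r s t u) :
    ∃ i j : ℤ, g = sapd r s t u ^ i * sapb r s t u ^ j := by
  have hc : Commute (sapd r s t u) (sapb r s t u) := sapd_mul_sapb r s t u
  induction hg using Subgroup.closure_induction with
  | mem x hx =>
    rcases hx with rfl | rfl
    · exact ⟨1, 0, by simp⟩
    · exact ⟨0, 1, by simp⟩
  | one => exact ⟨0, 0, by simp⟩
  | mul x y _ _ hx hy =>
    obtain ⟨i, j, rfl⟩ := hx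
    obtain ⟨k, l, rfl⟩ := hy
    refine ⟨i + k, j + l, ?_⟩
    rw [_root_.zpow_add, _root_.zpow_add, mul_assoc, mul_assoc, ← mul_assoc (sapb r s t u ^ j),
      ← (hc.zpow_zpow k j).eq, mul_assoc]
  | inv x _ hx =>
    obtain ⟨i, j, rfl⟩ := hx
    exact ⟨-i, -j, by rw [_root_.mul_inv_rev, ← _root_.zpow_neg, ← _root_.zpow_neg, (hc.zpow_zpow _ _).eq]⟩

/-- An element that conjugates, in both directions, a generating set of a subgroup into the
subgroup normalizes it. -/
lemma Subgroup.mem_normalizer_closure_of_conj {G : Type*} [Group G] {S : Set G} {g : G}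
    (h : ∀ x ∈ S, g * x * g⁻¹ ∈ Subgroup.closure S)
    (h' : ∀ x ∈ S, g⁻¹ * x * g ∈ Subgroup.closure S) :
    g ∈ Subgroup.normalizer (Subgroup.closure S : Set G) := by
  have key : ∀ k : G, (∀ x ∈ S, k * x * k⁻¹ ∈ Subgroup.closure S) →
      ∀ x ∈ Subgroup.closure S, k * x * k⁻¹ ∈ Subgroup.closure S := by
    intro k hk
    have : Subgroup.closure S ≤ (Subgroup.closure S).comap (MulAut.conj k).toMonoidHom := by
      rw [Subgroup.closure_le]
      intro x hx
      simpa using hk x hx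
    intro x hx
    simpa using this hx
  rw [Subgroup.mem_normalizer_iff]
  intro x
  refine ⟨key g h x, fun hx => ?_⟩
  have := key g⁻¹ (by simpa using h') _ hx
  simpa [mul_assoc] using this

lemma sapv_inv_conj_sapd (h1 : r * u - s * t = 1) :
    (sapv r s t u)⁻¹ * sapd r s t u * sapv r s t u =
      sapd r s t u ^ (r * u + s * t) * sapb r s t u ^ (2 * s * u) := by
  have hc : Commute (sapd r s t u) (sapb r s t u) := sapd_mul_sapb r s t u
  have hz : ∀ (x : Sapphire r s t u) (n : ℤ), sapv r s t u * x ^ n * (sapv r s t u)⁻¹ =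
    (sapv r s t u * x * (sapv r s t u)⁻¹) ^ n := fun x n => (conj_zpow).symm
  have key : sapv r s t u * (sapd r s t u ^ (r * u + s * t) * sapb r s t u ^ (2 * s * u)) *
      (sapv r s t u)⁻¹ = sapd r s t u := by
    rw [← conj_mul, hz, hz, sapv_conj_sapd, sapv_conj_sapb, (hc.zpow_zpow _ _).mul_zpow,
      (hc.zpow_zpow _ _).mul_zpow, ← _root_.zpow_mul, ← _root_.zpow_mul, ← _root_.zpow_mul, ← _root_.zpow_mul,
      mul_assoc (sapd r s t u ^ _), ← mul_assoc (sapb r s t u ^ _), ← (hc.zpow_zpow _ _).eq,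
      mul_assoc (sapd r s t u ^ _), ← _root_.zpow_add, ← mul_assoc (sapd r s t u ^ _), ← _root_.zpow_add]
    have e1 : (r * u + s * t) * (r * u + s * t) + -(2 * r * t) * (2 * s * u) = 1 := by
      linear_combination (r * u - s * t + 1) * h1
    have e2 : -(2 * s * u) * (r * u + s * t) + (r * u + s * t) * (2 * s * u) = 0 := by ring
    rw [e1, e2]
    simp
  rw [mul_assoc, inv_mul_eq_iff_eq_mul]
  exact (mul_inv_eq_iff_eq_mul.mp key).symm

lemma sapv_inv_conj_sapb (h1 : r * u - s * t = 1) :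
    (sapv r s t u)⁻¹ * sapb r s t u * sapv r s t u =
      sapd r s t u ^ (2 * r * t) * sapb r s t u ^ (r * u + s * t) := by
  have hc : Commute (sapd r s t u) (sapb r s t u) := sapd_mul_sapb r s t u
  have hz : ∀ (x : Sapphire r s t u) (n : ℤ), sapv r s t u * x ^ n * (sapv r s t u)⁻¹ =
    (sapv r s t u * x * (sapv r s t u)⁻¹) ^ n := fun x n => (conj_zpow).symm
  have key : sapv r s t u * (sapd r s t u ^ (2 * r * t) * sapb r s t u ^ (r * u + s * t)) *
      (sapv r s t u)⁻¹ = sapb r s t u := by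
    rw [← conj_mul, hz, hz, sapv_conj_sapd, sapv_conj_sapb, (hc.zpow_zpow _ _).mul_zpow,
      (hc.zpow_zpow _ _).mul_zpow, ← _root_.zpow_mul, ← _root_.zpow_mul, ← _root_.zpow_mul, ← _root_.zpow_mul,
      mul_assoc (sapd r s t u ^ _), ← mul_assoc (sapb r s t u ^ _), ← (hc.zpow_zpow _ _).eq,
      mul_assoc (sapd r s t u ^ _), ← _root_.zpow_add, ← mul_assoc (sapd r s t u ^ _), ← _root_.zpow_add]
    have e1 : (r * u + s * t) * (2 * r * t) + -(2 * r * t) * (r * u + s * t) = 0 := by ring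
    have e2 : -(2 * s * u) * (2 * r * t) + (r * u + s * t) * (r * u + s * t) = 1 := by
      linear_combination (r * u - s * t + 1) * h1
    rw [e1, e2]
    simp
  rw [mul_assoc, inv_mul_eq_iff_eq_mul]
  exact (mul_inv_eq_iff_eq_mul.mp key).symm

lemma sapDB_normal (h1 : r * u - s * t = 1) : (sapDB r s t u).Normal := by
  have hd := sapd_mem_sapDB r s t u
  have hb := sapb_mem_sapDB r s t u
  rw [← Subgroup.normalizer_eq_top_iff, eq_top_iff, ← sapphire_closure_eq_top,
    Subgroup.closure_le]
  rintro x (rfl | rfl | rfl | rfl)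
  · exact Subgroup.le_normalizer hd
  · exact Subgroup.le_normalizer hb
  · refine Subgroup.mem_normalizer_closure_of_conj ?_ ?_
    · rintro x (rfl | rfl)
      · rw [sapv_conj_sapd]
        exact mul_mem (zpow_mem hd _) (zpow_mem hb _)
      · rw [sapv_conj_sapb]
        exact mul_mem (zpow_mem hd _) (zpow_mem hb _)
    · rintro x (rfl | rfl)
      · rw [sapv_inv_conj_sapd r s t u h1]
        exact mul_mem (zpow_mem hd _) (zpow_mem hb _)
      · rw [sapv_inv_conj_sapb r s t u h1]
        exact mul_mem (zpow_mem hd _) (zpow_mem hb _)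
  · refine Subgroup.mem_normalizer_closure_of_conj ?_ ?_
    · rintro x (rfl | rfl)
      · have : sapa r s t u * sapd r s t u * (sapa r s t u)⁻¹ = sapd r s t u := by
          rw [← sapa_sq]; group
        rw [this]
        exact hd
      · rw [sapa_conj_sapb]
        exact inv_mem hb
    · rintro x (rfl | rfl)
      · have : (sapa r s t u)⁻¹ * sapd r s t u * sapa r s t u = sapd r s t u := by
          rw [← sapa_sq]; group
        rw [this]
        exact hd
      · have : (sapa r s t u)⁻¹ * sapb r s t u * sapa r s t u = (sapb r s t u)⁻¹ := by
          rw [mul_assoc, inv_mul_eq_iff_eq_mul, eq_comm, ← mul_inv_eq_iff_eq_mul, ← conj_inv, sapa_conj_sapb, inv_inv]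
        rw [this]
        exact inv_mem hb

/-- A group generated by `v` and an involution `a` inverting `v` is `⟨v⟩ ∪ ⟨v⟩ a`. -/
lemma exists_zpow_or_zpow_mul_of_closure_eq_top {Q : Type*} [Group Q] {v a : Q}
    (hQ : Subgroup.closure {v, a} = ⊤) (ha : a ^ 2 = 1) (hav : a * v * a⁻¹ = v⁻¹) (q : Q) :
    ∃ k : ℤ, q = v ^ k ∨ q = v ^ k * a := by
  have ha' : a⁻¹ = a := inv_eq_of_mul_eq_one_left (by rw [← sq, ha])
  have haa : a * a = 1 := by rw [← sq, ha]
  have hk : ∀ k : ℤ, a * v ^ k = v ^ (-k) * a := by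
    intro k
    rw [← mul_inv_eq_iff_eq_mul, ← conj_zpow, hav, _root_.inv_zpow']
  have hq : q ∈ Subgroup.closure {v, a} := hQ ▸ Subgroup.mem_top q
  have hmul : ∀ x y : Q, (∃ k : ℤ, x = v ^ k ∨ x = v ^ k * a) →
      (∃ k : ℤ, y = v ^ k ∨ y = v ^ k * a) → ∃ k : ℤ, x * y = v ^ k ∨ x * y = v ^ k * a := by
    rintro x y ⟨k, rfl | rfl⟩ ⟨l, rfl | rfl⟩
    · exact ⟨k + l, Or.inl (_root_.zpow_add v k l).symm⟩
    · exact ⟨k + l, Or.inr (by rw [_root_.zpow_add, mul_assoc])⟩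
    · exact ⟨k + -l, Or.inr (by rw [mul_assoc, hk, _root_.zpow_add, mul_assoc])⟩
    · exact ⟨k + -l, Or.inl (by
        rw [mul_assoc, ← mul_assoc a, hk, mul_assoc, haa, mul_one, _root_.zpow_add])⟩
  induction hq using Subgroup.closure_induction with
  | mem x hx =>
    rcases hx with rfl | rfl
    · exact ⟨1, Or.inl (by simp)⟩
    · exact ⟨0, Or.inr (by simp)⟩
  | one => exact ⟨0, Or.inl (by simp)⟩
  | mul x y _ _ hx hy => exact hmul x y hx hy
  | inv x _ hx =>
    obtain ⟨k, rfl | rfl⟩ := hx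
    · exact ⟨-k, Or.inl (by simp)⟩
    · exact ⟨k, Or.inr (by rw [_root_.mul_inv_rev, ha', ← _root_.zpow_neg, hk, neg_neg])⟩

lemma sapphire_normal_form {r s t u : ℤ} (h1 : r * u - s * t = 1) (g : Sapphire r s t u) :
    ∃ i j k : ℤ, g = sapd r s t u ^ i * sapb r s t u ^ j * sapv r s t u ^ k ∨
      g = sapd r s t u ^ i * sapb r s t u ^ j * sapv r s t u ^ k * sapa r s t u := by
  have := sapDB_normal r s t u h1
  let π := QuotientGroup.mk' (sapDB r s t u)
  have hd : π (sapd r s t u) = 1 := (QuotientGroup.eq_one_iff _).2 (sapd_mem_sapDB r s t u)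
  have hb : π (sapb r s t u) = 1 := (QuotientGroup.eq_one_iff _).2 (sapb_mem_sapDB r s t u)
  have hQ : Subgroup.closure {π (sapv r s t u), π (sapa r s t u)} = ⊤ := by
    rw [← Subgroup.map_top_of_surjective π (QuotientGroup.mk'_surjective _),
      ← sapphire_closure_eq_top, MonoidHom.map_closure]
    simp [Set.image_insert_eq, hd, hb, Subgroup.closure_insert_one]
  obtain ⟨k, hk⟩ := exists_zpow_or_zpow_mul_of_closure_eq_top hQ
    (by rw [← map_pow, sapa_sq, hd])
    (by rw [← map_inv, ← map_mul, ← map_mul, sapa_conj_sapv]; simp [hd, hb]) (π g)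
  have lift : ∀ x : Sapphire r s t u, π g = π x →
      ∃ i j : ℤ, g = sapd r s t u ^ i * sapb r s t u ^ j * x := by
    intro x hx
    have hm : g * x⁻¹ ∈ sapDB r s t u := by
      rw [← QuotientGroup.eq_one_iff]
      change π (g * x⁻¹) = 1
      rw [map_mul, hx, ← map_mul, mul_inv_cancel, map_one]
    obtain ⟨i, j, hij⟩ := mem_sapDB hm
    exact ⟨i, j, by rw [← hij, inv_mul_cancel_right]⟩
  rcases hk with hk | hk
  · obtain ⟨i, j, h⟩ := lift (sapv r s t u ^ k) (by rw [hk, map_zpow])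
    exact ⟨i, j, k, Or.inl h⟩
  · obtain ⟨i, j, h⟩ := lift (sapv r s t u ^ k * sapa r s t u) (by rw [hk, map_mul, map_zpow])
    exact ⟨i, j, k, Or.inr (by rw [h, mul_assoc, mul_assoc, mul_assoc])⟩

end NormalForm

section AffineAction

variable {r s t u : ℤ}

/-- The linear map of the plane by which `v` acts. -/
noncomputable def affV (r s t u : ℤ) (h1 : r * u - s * t = 1) : Equiv.Perm (ℝ × ℝ) where
  toFun p := ((r * u + s * t) * p.1 - 2 * r * t * p.2, -2 * s * u * p.1 + (r * u + s * t) * p.2)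
  invFun p := ((r * u + s * t) * p.1 + 2 * r * t * p.2, 2 * s * u * p.1 + (r * u + s * t) * p.2)
  left_inv p := by
    have h : (r * u - s * t : ℝ) = 1 := by exact_mod_cast h1
    ext
    · linear_combination (r * u - s * t + 1 : ℝ) * p.1 * h
    · linear_combination (r * u - s * t + 1 : ℝ) * p.2 * h
  right_inv p := by
    have h : (r * u - s * t : ℝ) = 1 := by exact_mod_cast h1
    ext
    · linear_combination (r * u - s * t + 1 : ℝ) * p.1 * h
    · linear_combination (r * u - s * t + 1 : ℝ) * p.2 * h

/-- The glide reflection of the plane by which `a` acts. -/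
noncomputable def affA (t u : ℤ) : Equiv.Perm (ℝ × ℝ) where
  toFun p := (p.1 + 1 / 2, (u - 1) / (2 * t) - p.2)
  invFun p := (p.1 - 1 / 2, (u - 1) / (2 * t) - p.2)
  left_inv p := by ext <;> simp
  right_inv p := by ext <;> simp

/-- The images of the generators of the sapphire group in the affine group of the plane. -/
noncomputable def affGen (r s t u : ℤ) (h1 : r * u - s * t = 1) : Fin 4 → Equiv.Perm (ℝ × ℝ) :=
  ![Equiv.addRight (1, 0), Equiv.addRight (0, 1), affV r s t u h1, affA t u]

lemma affGen_rels (h1 : r * u - s * t = 1) (ht : t ≠ 0) :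
    ∀ x ∈ sapphireRels r s t u, FreeGroup.lift (affGen r s t u h1) x = 1 := by
  have h : (r * u - s * t : ℝ) = 1 := by exact_mod_cast h1
  have ht' : (t : ℝ) ≠ 0 := by exact_mod_cast ht
  rintro x (rfl | rfl | rfl | rfl | rfl | rfl)
  · simp only [map_mul, map_inv, FreeGroup.lift_apply_of, affGen]
    rw [mul_inv_eq_one, mul_inv_eq_iff_eq_mul]
    ext p <;> simp
  · simp only [map_mul, map_inv, map_zpow, FreeGroup.lift_apply_of, affGen]
    rw [mul_inv_eq_one, mul_inv_eq_iff_eq_mul]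
    ext p <;> simp [affV] <;> ring
  · simp only [map_mul, map_inv, map_zpow, FreeGroup.lift_apply_of, affGen]
    rw [mul_inv_eq_one, mul_inv_eq_iff_eq_mul]
    ext p <;> simp [affV] <;> ring
  · simp only [map_mul, map_inv, map_pow, FreeGroup.lift_apply_of, affGen]
    rw [mul_inv_eq_one]
    ext p <;> simp [affA, sq] <;> ring
  · simp only [map_mul, map_inv, FreeGroup.lift_apply_of, affGen]
    rw [← eq_inv_iff_mul_eq_one, mul_inv_eq_iff_eq_mul]
    ext p <;> simp [affA] <;> ring
  · simp only [map_mul, map_inv, map_zpow, FreeGroup.lift_apply_of, affGen]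
    rw [mul_inv_eq_one, mul_inv_eq_iff_eq_mul]
    ext p
    · simp [affA, affV, Equiv.Perm.inv_def]
      field_simp
      linear_combination -h
    · simp [affA, affV, Equiv.Perm.inv_def]
      field_simp
      linear_combination (1 - u) * h

/-- The affine action of the sapphire group on the plane. -/
noncomputable def affRep (h1 : r * u - s * t = 1) (ht : t ≠ 0) : Sapphire r s t u →* Equiv.Perm (ℝ × ℝ) :=
  PresentedGroup.toGroup (affGen_rels h1 ht)

lemma affRep_sapd (h1 : r * u - s * t = 1) (ht : t ≠ 0) :
    affRep h1 ht (sapd r s t u) = Equiv.addRight (1, 0) :=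
  PresentedGroup.toGroup.of _

lemma affRep_sapb (h1 : r * u - s * t = 1) (ht : t ≠ 0) :
    affRep h1 ht (sapb r s t u) = Equiv.addRight (0, 1) :=
  PresentedGroup.toGroup.of _

lemma affRep_sapv (h1 : r * u - s * t = 1) (ht : t ≠ 0) :
    affRep h1 ht (sapv r s t u) = affV r s t u h1 :=
  PresentedGroup.toGroup.of _

lemma affRep_sapa (h1 : r * u - s * t = 1) (ht : t ≠ 0) :
    affRep h1 ht (sapa r s t u) = affA t u :=
  PresentedGroup.toGroup.of _

/-- A linear functional which is an eigenvector of the transpose of `affV`, if `w ^ 2 = rstu`. -/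
noncomputable def affEigen (s u : ℤ) (w : ℝ) (p : ℝ × ℝ) : ℝ := s * u * p.1 - w * p.2

lemma affEigen_affV (h1 : r * u - s * t = 1) {w : ℝ} (hw : w ^ 2 = r * s * t * u) (p : ℝ × ℝ) :
    affEigen s u w (affV r s t u h1 p) = (r * u + s * t + 2 * w) * affEigen s u w p := by
  simp only [affEigen, affV, Equiv.coe_fn_mk]
  linear_combination 2 * p.2 * hw

lemma affEigen_affV_zpow (h1 : r * u - s * t = 1) {w : ℝ} (hw : w ^ 2 = r * s * t * u)
    (hl : (r * u + s * t + 2 * w : ℝ) ≠ 0) (k : ℤ) (p : ℝ × ℝ) :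
    affEigen s u w ((affV r s t u h1 ^ k) p) =
      (r * u + s * t + 2 * w) ^ k * affEigen s u w p := by
  induction k using Int.induction_on generalizing p with
  | zero => simp
  | succ n ih =>
    rw [_root_.zpow_add_one, zpow_add_one₀ hl, Equiv.Perm.mul_apply, ih, affEigen_affV h1 hw, mul_assoc]
  | pred n ih =>
    rw [_root_.zpow_sub_one, zpow_sub_one₀ hl, Equiv.Perm.mul_apply, ih, mul_assoc]
    congr 1
    rw [eq_inv_mul_iff_mul_eq₀ hl, ← affEigen_affV h1 hw, Equiv.Perm.coe_inv,
      Equiv.apply_symm_apply]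

/-- The centralizer of `⟨d, b, v⟩` in the sapphire group is trivial. -/
lemma eq_one_of_commute_sapd_sapb_sapv (h1 : r * u - s * t = 1) (h0 : r * s * t * u ≠ 0)
    {g : Sapphire r s t u} (hd : Commute g (sapd r s t u)) (hb : Commute g (sapb r s t u))
    (hv : Commute g (sapv r s t u)) : g = 1 := by
  have hs : s ≠ 0 := by rintro rfl; simp at h0
  have ht : t ≠ 0 := by rintro rfl; simp at h0
  have hu : u ≠ 0 := by rintro rfl; simp at h0
  have h : (r * u - s * t : ℝ) = 1 := by exact_mod_cast h1
  have hsu : (s * u : ℝ) ≠ 0 := by exact_mod_cast mul_ne_zero hs hu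
  have hpos : 0 < r * s * t * u := by
    have e : r * s * t * u = s * t * (s * t + 1) := by linear_combination s * t * h1
    rcases lt_trichotomy (s * t) (-1) with hl | hl | hl
    · rw [e]; nlinarith
    · rw [e, hl] at h0; simp at h0
    · have : s * t ≠ 0 := mul_ne_zero hs ht
      rw [e]
      have : 0 < s * t := by omega
      positivity
  have hpos' : (0 : ℝ) < r * s * t * u := by exact_mod_cast hpos
  obtain ⟨w, hw0, hw⟩ : ∃ w : ℝ, 0 < w ∧ w ^ 2 = r * s * t * u :=
    ⟨√(r * s * t * u), Real.sqrt_pos.2 hpos', Real.sq_sqrt hpos'.le⟩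
  set l : ℝ := r * u + s * t + 2 * w with hl
  have hl1 : l * (l - 4 * w) = 1 := by
    rw [hl]; linear_combination (r * u - s * t + 1 : ℝ) * h - 4 * hw
  have hl0 : l ≠ 0 := left_ne_zero_of_mul_eq_one hl1
  have habs : |l| ≠ 1 := by
    intro ha
    rcases eq_or_eq_neg_of_abs_eq ha with e | e <;> rw [e] at hl1 <;> linarith
  have hpow : ∀ k : ℤ, l ^ k = 1 → k = 0 := by
    intro k hk
    rw [← zpow_eq_one_iff_right₀ (abs_nonneg l) habs, ← abs_zpow, hk, abs_one]
  have hd' : ∀ p, affRep h1 ht g (p + (1, 0)) = affRep h1 ht g p + (1, 0) := fun p => by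
    simpa [affRep_sapd] using congrArg (fun x => affRep h1 ht x p) hd.eq
  have hb' : ∀ p, affRep h1 ht g (p + (0, 1)) = affRep h1 ht g p + (0, 1) := fun p => by
    simpa [affRep_sapb] using congrArg (fun x => affRep h1 ht x p) hb.eq
  have hv' : ∀ p, affRep h1 ht g (affV r s t u h1 p) = affV r s t u h1 (affRep h1 ht g p) :=
    fun p => by simpa [affRep_sapv] using congrArg (fun x => affRep h1 ht x p) hv.eq
  have hadd : ∀ p q : ℝ × ℝ, affEigen s u w (p + q) = affEigen s u w p + affEigen s u w q := by
    intro p q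
    simp only [affEigen, Prod.fst_add, Prod.snd_add]
    ring
  have hzpow := affEigen_affV_zpow h1 hw hl0
  rw [← hl] at hzpow
  obtain ⟨i, j, k, rfl | rfl⟩ := sapphire_normal_form h1 g
  · have e1 := congrArg (affEigen s u w) (hd' 0)
    simp only [map_mul, map_zpow, affRep_sapd, affRep_sapb, affRep_sapv, Equiv.Perm.mul_apply,
      Equiv.zsmul_addRight, Equiv.coe_addRight, hadd, hzpow] at e1
    obtain rfl : k = 0 := hpow k (mul_right_cancel₀ hsu (by
      simp [affEigen] at e1
      linarith))
    have e2 := hv' 0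
    simp [affRep_sapd, affRep_sapb, affV] at e2
    obtain ⟨e2, e3⟩ := e2
    have e2' : i = (r * u + s * t) * i - 2 * r * t * j := by exact_mod_cast e2
    have e3' : j = -(2 * s * u * i) + (r * u + s * t) * j := by exact_mod_cast e3
    have e4 : s * i = r * j := mul_left_cancel₀ (mul_ne_zero two_ne_zero ht) (by
      linear_combination -e2' - i * h1)
    have e5 : u * i = t * j := mul_left_cancel₀ (mul_ne_zero two_ne_zero hs) (by
      linear_combination e3' + j * h1)
    obtain rfl : j = 0 := by linear_combination -u * e4 + s * e5 - j * h1
    obtain rfl : i = 0 := by simpa [hs] using e4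
    simp
  · have e1 := congrArg (affEigen s u w) (hd' 0)
    have e2 := congrArg (affEigen s u w) (hb' 0)
    simp only [map_mul, map_zpow, affRep_sapd, affRep_sapb, affRep_sapv, affRep_sapa,
      Equiv.Perm.mul_apply, Equiv.zsmul_addRight, Equiv.coe_addRight, hadd, hzpow] at e1 e2
    have e3 : l ^ k = 1 := mul_right_cancel₀ hsu (by
      simp [affEigen, affA] at e1
      linarith)
    simp [affEigen, affA, e3] at e2
    linarith

end AffineAction

/-- An automorphism of the sapphire group fixing `d`, `b` and `v` is the
identity; equivalently, the restriction map `Aut(E) → Aut(⟨d, b, v⟩)` is injective. -/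
theorem stmt10 (r s t u : ℤ) (h1 : r * u - s * t = 1) (h0 : r * s * t * u ≠ 0)
    (φ : MulAut (Sapphire r s t u))
    (hd : φ (sapd r s t u) = sapd r s t u)
    (hb : φ (sapb r s t u) = sapb r s t u)
    (hv : φ (sapv r s t u) = sapv r s t u) :
    φ = 1 := by
  have hconj : ∀ n, φ n = n →
      φ (sapa r s t u * n * (sapa r s t u)⁻¹) = sapa r s t u * n * (sapa r s t u)⁻¹ →
      Commute ((sapa r s t u)⁻¹ * φ (sapa r s t u)) n := by
    intro n hn h
    rw [map_mul, map_mul, map_inv, hn, mul_inv_eq_iff_eq_mul] at h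
    rw [commute_iff_eq, mul_assoc, h]
    group
  have ha : φ (sapa r s t u) = sapa r s t u := by
    rw [eq_comm, ← inv_mul_eq_one]
    refine eq_one_of_commute_sapd_sapb_sapv h1 h0 (hconj _ hd ?_) (hconj _ hb ?_) (hconj _ hv ?_)
    · have : sapa r s t u * sapd r s t u * (sapa r s t u)⁻¹ = sapd r s t u := by
        rw [← sapa_sq]; group
      rw [this, hd]
    · rw [sapa_conj_sapb, map_inv, hb]
    · rw [sapa_conj_sapv]
      simp only [map_mul, map_inv, map_zpow, hd, hb, hv]
  ext x
  refine DFunLike.congr_fun (f := φ.toMonoidHom) (g := MonoidHom.id _) ?_ x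
  refine MonoidHom.eq_of_eqOn_dense (sapphire_closure_eq_top r s t u) ?_
  rintro x (rfl | rfl | rfl | rfl) <;> assumption
end

section
/- Let M₀ ∈ GL(2,ℤ) be an Anosov matrix whose two diagonal entries are equal, let ε ∈ {1, −1} and let ℓ₀ be a nonzero integer such that the matrix θ = ε·M₀^{ℓ₀} has determinant 1. Let D = [[1, 0], [0, −1]]. Then for all integers k and ℓ, the matrix D · M₀^{−ℓ} · θ^k · D · M₀^{ℓ} fixes the column vector (0, 1) if and only if 2ℓ = k·ℓ₀ and ε^k · (det M₀)^ℓ = 1. -/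
open Matrix SemidirectProduct Multiplicative

/-- A matrix in `GL(2,ℤ)` is exceptional if `det = 1` and `|tr| ≤ 2`, or `det = -1` and
`tr = 0`. -/
def IsExceptional (A : GL2Z) : Prop :=
  ((A : Matrix (Fin 2) (Fin 2) ℤ).det = 1 ∧ |(A : Matrix (Fin 2) (Fin 2) ℤ).trace| ≤ 2) ∨
    ((A : Matrix (Fin 2) (Fin 2) ℤ).det = -1 ∧ (A : Matrix (Fin 2) (Fin 2) ℤ).trace = 0)

/-- Anosov = not exceptional. -/
def IsAnosov (A : GL2Z) : Prop := ¬ IsExceptional A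

/-- The linear action of a 2×2 integer matrix on `ℤ × ℤ`. -/
def mulVec2 (M : Matrix (Fin 2) (Fin 2) ℤ) (p : ℤ × ℤ) : ℤ × ℤ :=
  (M 0 0 * p.1 + M 0 1 * p.2, M 1 0 * p.1 + M 1 1 * p.2)

/-- `D = [[1, 0], [0, -1]]` as an element of `GL(2,ℤ)`. -/
def Dgl : GL2Z :=
  ⟨!![1, 0; 0, -1], !![1, 0; 0, -1],
    by decide,
    by decide⟩

/-- The determinant of an element of `GL(2,ℤ)`, as a unit of `ℤ`. -/
def detU (A : GL2Z) : ℤˣ :=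
  Units.map (Matrix.detMonoidHom : Matrix (Fin 2) (Fin 2) ℤ →* ℤ) A

/-- The scalar matrices `± 1` in `GL(2,ℤ)`. -/
def scalarGL : ℤˣ →* GL2Z :=
  Units.map (Matrix.scalar (Fin 2) : ℤ →+* Matrix (Fin 2) (Fin 2) ℤ).toMonoidHom

lemma coe_scalarGL (u : ℤˣ) :
    (scalarGL u : Matrix (Fin 2) (Fin 2) ℤ) = Matrix.diagonal fun _ => (u : ℤ) := rfl

lemma coe_scalarGL_mul (u : ℤˣ) (A : GL2Z) :
    ((scalarGL u * A : GL2Z) : Matrix (Fin 2) (Fin 2) ℤ) =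
      (u : ℤ) • (A : Matrix (Fin 2) (Fin 2) ℤ) := by
  rw [Units.val_mul, coe_scalarGL, ← Matrix.smul_eq_diagonal_mul]

lemma scalarGL_commute (u : ℤˣ) (A : GL2Z) : Commute (scalarGL u) A := by
  refine Units.ext ?_
  ext i j
  rw [Units.val_mul, Units.val_mul, coe_scalarGL, Matrix.diagonal_mul, Matrix.mul_diagonal,
    mul_comm]

lemma Dgl_mul_self : Dgl * Dgl = 1 := Units.ext Dgl.val_inv

lemma coe_Dgl : (Dgl : Matrix (Fin 2) (Fin 2) ℤ) = !![1, 0; 0, -1] := rfl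

lemma Dgl_conj_zpow (A : GL2Z) (n : ℤ) : Dgl * A ^ n * Dgl = (Dgl * A * Dgl) ^ n := by
  have h : Dgl⁻¹ = Dgl := inv_eq_of_mul_eq_one_left Dgl_mul_self
  have := conj_zpow (a := Dgl) (b := A) (i := n)
  rw [h] at this
  exact this.symm

lemma coe_detU (A : GL2Z) : (detU A : ℤ) = (A : Matrix (Fin 2) (Fin 2) ℤ).det := rfl

lemma Dgl_conj_of_diag_eq (A : GL2Z)
    (h : (A : Matrix (Fin 2) (Fin 2) ℤ) 0 0 = (A : Matrix (Fin 2) (Fin 2) ℤ) 1 1) :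
    Dgl * A * Dgl = scalarGL (detU A) * A⁻¹ := by
  rw [eq_mul_inv_iff_mul_eq]
  refine Units.ext ?_
  rw [← mul_one (scalarGL _), coe_scalarGL_mul, coe_detU, Matrix.det_fin_two]
  ext i j
  fin_cases i <;> fin_cases j <;>
    simp only [Units.val_mul, coe_Dgl, Matrix.mul_apply, Fin.sum_univ_two] <;> simp [h] <;> ring

lemma bounds_of_isAnosov {A : GL2Z} (hA : IsAnosov A)
    (h : (A : Matrix (Fin 2) (Fin 2) ℤ) 0 0 = (A : Matrix (Fin 2) (Fin 2) ℤ) 1 1) :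
    (A : Matrix (Fin 2) (Fin 2) ℤ) 0 0 ≠ 0 ∧
      0 < (A : Matrix (Fin 2) (Fin 2) ℤ) 0 1 * (A : Matrix (Fin 2) (Fin 2) ℤ) 1 0 := by
  have hd : (A : Matrix (Fin 2) (Fin 2) ℤ).det = 1 ∨
      (A : Matrix (Fin 2) (Fin 2) ℤ).det = -1 := by
    rw [← coe_detU]
    rcases Int.units_eq_one_or (detU A) with h | h <;> simp [h]
  simp only [IsAnosov, IsExceptional, Matrix.trace_fin_two, not_or, not_and, not_le] at hA
  obtain ⟨h₁, h₂⟩ := hA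
  rw [Matrix.det_fin_two] at hd h₁ h₂
  rw [← h] at hd h₁ h₂
  generalize (A : Matrix (Fin 2) (Fin 2) ℤ) 0 0 = a at *
  rcases hd with hd | hd
  · have h₃ := h₁ hd
    rcases lt_abs.1 h₃ with h₄ | h₄
    · exact ⟨by omega, by nlinarith⟩
    · exact ⟨by omega, by nlinarith⟩
  · have h₃ := h₂ hd
    exact ⟨by omega, by nlinarith [sq_nonneg a]⟩

lemma exists_pow_entries (A : Matrix (Fin 2) (Fin 2) ℤ) (h : A 0 0 = A 1 1) (h₀ : A 0 0 ≠ 0)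
    (hpos : 0 < A 0 1 * A 1 0) (n : ℕ) :
    ∃ p s : ℤ, (A ^ (n + 1)) 0 1 = A 0 1 * s ∧ (A ^ (n + 1)) 1 1 = p ∧ 0 < A 0 0 * p * s := by
  induction n with
  | zero =>
    refine ⟨A 1 1, 1, by simp, by simp, ?_⟩
    rw [← h, mul_one]
    exact mul_self_pos.2 h₀
  | succ n ih =>
    obtain ⟨p, s, h₁, h₂, h₃⟩ := ih
    refine ⟨A 0 0 * p + A 0 1 * A 1 0 * s, p + A 0 0 * s, ?_, ?_, ?_⟩
    · rw [pow_succ', Matrix.mul_apply, Fin.sum_univ_two, h₁, h₂]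
      ring
    · rw [pow_succ', Matrix.mul_apply, Fin.sum_univ_two, h₁, h₂, ← h]
      ring
    · have e : A 0 0 * (A 0 0 * p + A 0 1 * A 1 0 * s) * (p + A 0 0 * s) =
          (A 0 0 * p) ^ 2 + A 0 1 * A 1 0 * (A 0 0 * s) ^ 2 +
            ((A 0 0) ^ 2 + A 0 1 * A 1 0) * (A 0 0 * p * s) := by ring
      rw [e]
      positivity

lemma pow_apply_zero_one_ne_zero {A : GL2Z} (hA : IsAnosov A)
    (h : (A : Matrix (Fin 2) (Fin 2) ℤ) 0 0 = (A : Matrix (Fin 2) (Fin 2) ℤ) 1 1)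
    {n : ℕ} (hn : n ≠ 0) : ((A ^ n : GL2Z) : Matrix (Fin 2) (Fin 2) ℤ) 0 1 ≠ 0 := by
  obtain ⟨m, rfl⟩ := Nat.exists_eq_succ_of_ne_zero hn
  obtain ⟨h₀, hpos⟩ := bounds_of_isAnosov hA h
  obtain ⟨p, s, h₁, -, h₃⟩ := exists_pow_entries _ h h₀ hpos m
  rw [Units.val_pow_eq_pow_val, h₁]
  exact mul_ne_zero (left_ne_zero_of_mul hpos.ne') (right_ne_zero_of_mul h₃.ne')

lemma inv_apply_zero_one (A : GL2Z) :
    ((A⁻¹ : GL2Z) : Matrix (Fin 2) (Fin 2) ℤ) 0 1 =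
      -((detU A : ℤ) * (A : Matrix (Fin 2) (Fin 2) ℤ) 0 1) := by
  rw [Matrix.coe_units_inv, Matrix.inv_def, Matrix.adjugate_fin_two, ← coe_detU,
    Ring.inverse_unit, Int.units_inv_eq_self]
  simp

lemma zpow_apply_zero_one_ne_zero {A : GL2Z} (hA : IsAnosov A)
    (h : (A : Matrix (Fin 2) (Fin 2) ℤ) 0 0 = (A : Matrix (Fin 2) (Fin 2) ℤ) 1 1)
    {n : ℤ} (hn : n ≠ 0) : ((A ^ n : GL2Z) : Matrix (Fin 2) (Fin 2) ℤ) 0 1 ≠ 0 := by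
  obtain ⟨m, rfl | rfl⟩ := n.eq_nat_or_neg
  · rw [zpow_natCast]
    exact pow_apply_zero_one_ne_zero hA h (by simpa using hn)
  · rw [_root_.zpow_neg, zpow_natCast, inv_apply_zero_one]
    exact neg_ne_zero.2 (mul_ne_zero (Units.ne_zero _)
      (pow_apply_zero_one_ne_zero hA h (by simpa using hn)))

lemma detU_zpow_eq_one {A θ : GL2Z} {ε : ℤˣ} {n : ℤ}
    (hθ : (θ : Matrix (Fin 2) (Fin 2) ℤ) = (ε : ℤ) • ((A ^ n : GL2Z) : Matrix (Fin 2) (Fin 2) ℤ))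
    (hdet : (θ : Matrix (Fin 2) (Fin 2) ℤ).det = 1) : detU A ^ n = 1 := by
  have h : detU (A ^ n) = detU A ^ n := map_zpow (Units.map Matrix.detMonoidHom : GL2Z →* ℤˣ) A n
  rw [← h]
  refine Units.ext ?_
  have hε : (ε : ℤ) ^ 2 = 1 := by rcases Int.units_eq_one_or ε with h | h <;> simp [h]
  rw [coe_detU, Units.val_one, ← hdet, hθ, Matrix.det_smul, Fintype.card_fin, hε, one_mul]

lemma Dgl_word_eq {A θ : GL2Z}
    (h : (A : Matrix (Fin 2) (Fin 2) ℤ) 0 0 = (A : Matrix (Fin 2) (Fin 2) ℤ) 1 1)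
    {ε : ℤˣ} {n : ℤ}
    (hθ : (θ : Matrix (Fin 2) (Fin 2) ℤ) = (ε : ℤ) • ((A ^ n : GL2Z) : Matrix (Fin 2) (Fin 2) ℤ))
    (hdet : (θ : Matrix (Fin 2) (Fin 2) ℤ).det = 1) (k l : ℤ) :
    Dgl * (A ^ l)⁻¹ * θ ^ k * Dgl * A ^ l =
      scalarGL (ε ^ k * detU A ^ l) * A ^ (2 * l - k * n) := by
  have hθ' : θ = scalarGL ε * A ^ n := Units.ext (by rw [hθ, coe_scalarGL_mul])
  have hd : detU A ^ (n * k - l) = detU A ^ l := by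
    rw [_root_.zpow_sub, _root_.zpow_mul, detU_zpow_eq_one hθ hdet, _root_.one_zpow, one_mul,
      Int.units_inv_eq_self]
  have hk : θ ^ k = scalarGL (ε ^ k) * A ^ (n * k) := by
    rw [hθ', (scalarGL_commute ε _).mul_zpow, ← map_zpow, _root_.zpow_mul]
  calc Dgl * (A ^ l)⁻¹ * θ ^ k * Dgl * A ^ l
      = (Dgl * (A ^ l)⁻¹ * scalarGL (ε ^ k)) * A ^ (n * k) * Dgl * A ^ l := by
        rw [hk]; group
    _ = scalarGL (ε ^ k) * (Dgl * A ^ (n * k - l) * Dgl) * A ^ l := by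
        rw [← (scalarGL_commute (ε ^ k) _).eq]; group
    _ = scalarGL (ε ^ k * detU A ^ l) * A ^ (2 * l - k * n) := by
        rw [Dgl_conj_zpow, Dgl_conj_of_diag_eq A h, (scalarGL_commute _ _).mul_zpow,
          ← map_zpow, hd, map_mul, _root_.inv_zpow', mul_assoc, mul_assoc,
          ← _root_.zpow_add, ← mul_assoc]
        congr 2
        ring

/-- Let `M₀` be Anosov with equal diagonal entries, `ε = ±1`, `ℓ₀ ≠ 0` and
`θ = ε • M₀ ^ ℓ₀` of determinant `1`. Then for all integers `k, ℓ`, the matrix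
`D M₀^{-ℓ} θ^k D M₀^ℓ` fixes `(0, 1)` iff `2ℓ = kℓ₀` and `ε^k (det M₀)^ℓ = 1`. -/
theorem stmt11 (M₀ : GL2Z) (hM : IsAnosov M₀)
    (hdiag : (M₀ : Matrix (Fin 2) (Fin 2) ℤ) 0 0 = (M₀ : Matrix (Fin 2) (Fin 2) ℤ) 1 1)
    (ε : ℤˣ) (ℓ₀ : ℤ) (hℓ₀ : ℓ₀ ≠ 0) (θ : GL2Z)
    (hθ : (θ : Matrix (Fin 2) (Fin 2) ℤ) =
      (ε : ℤ) • ((M₀ ^ ℓ₀ : GL2Z) : Matrix (Fin 2) (Fin 2) ℤ))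
    (hdet : (θ : Matrix (Fin 2) (Fin 2) ℤ).det = 1)
    (k ℓ : ℤ) :
    mulVec2 ((Dgl * (M₀ ^ ℓ)⁻¹ * θ ^ k * Dgl * M₀ ^ ℓ : GL2Z) : Matrix (Fin 2) (Fin 2) ℤ)
        (0, 1) = (0, 1) ↔
      (2 * ℓ = k * ℓ₀ ∧ ε ^ k * (detU M₀) ^ ℓ = 1) := by
  rw [Dgl_word_eq hdiag hθ hdet, coe_scalarGL_mul]
  constructor
  · intro h
    simp only [mulVec2, Matrix.smul_apply, smul_eq_mul, mul_zero, mul_one, zero_add,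
      Prod.mk.injEq] at h
    have hn : 2 * ℓ - k * ℓ₀ = 0 := by
      by_contra hn
      exact mul_ne_zero (Units.ne_zero _) (zpow_apply_zero_one_ne_zero hM hdiag hn) h.1
    refine ⟨sub_eq_zero.1 hn, Units.ext ?_⟩
    simpa [hn] using h.2
  · rintro ⟨h₁, h₂⟩
    rw [h₁, h₂, sub_self]
    simp [mulVec2]
end

section
/- Let E be the sapphire group determined by integers r, s, t, u with ru − st = 1 and rstu ≠ 0, and let Aut₀⁰(E) be the set of automorphisms φ of E such that φ maps the subgroup ⟨d, b⟩ onto itself, φ(v) ∈ ⟨d, b⟩·v, and φ(a) ∈ ⟨d, b⟩·a. Then Aut₀⁰(E) is a subgroup of Aut(E), there is a split short exact sequence 0 → ℤ × ℤ → Aut₀⁰(E) → ℤ/2 → 0, and Aut₀⁰(E) is isomorphic to the semidirect product (ℤ × ℤ) ⋊ ℤ/2 in which the nontrivial element of ℤ/2 acts on ℤ × ℤ by multiplication by −1. -/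
open Matrix SemidirectProduct Multiplicative

lemma mem_of_map_eq {G : Type*} [Group G] {K : Subgroup G} {φ : MulAut G}
    (h : K.map φ.toMonoidHom = K) {g : G} (hg : g ∈ K) : φ g ∈ K := by
  rw [← h]; exact ⟨g, hg, rfl⟩

lemma map_inv_eq_of_map_eq {G : Type*} [Group G] {K : Subgroup G} {φ : MulAut G}
    (h : K.map φ.toMonoidHom = K) : K.map (φ⁻¹ : MulAut G).toMonoidHom = K := by
  conv_lhs => rw [← h]
  rw [Subgroup.map_map]
  have hid : ((φ⁻¹ : MulAut G).toMonoidHom.comp φ.toMonoidHom) = MonoidHom.id G := by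
    refine MonoidHom.ext fun x => ?_
    show (φ⁻¹ : MulAut G) (φ x) = x
    simp
  rw [hid, Subgroup.map_id]

/-- The subgroup `Aut₀⁰(E)` of automorphisms of the sapphire group mapping `⟨d, b⟩` onto itself
and with `φ(v) ∈ ⟨d, b⟩ · v` and `φ(a) ∈ ⟨d, b⟩ · a`. -/
def sapAut₀₀ (r s t u : ℤ) : Subgroup (MulAut (Sapphire r s t u)) where
  carrier := {φ | (sapDB r s t u).map φ.toMonoidHom = sapDB r s t u ∧
    (∃ g ∈ sapDB r s t u, φ (sapv r s t u) = g * sapv r s t u) ∧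
    (∃ g ∈ sapDB r s t u, φ (sapa r s t u) = g * sapa r s t u)}
  one_mem' := by
    refine ⟨?_, ⟨1, one_mem _, by simp⟩, ⟨1, one_mem _, by simp⟩⟩
    have : ((1 : MulAut (Sapphire r s t u)).toMonoidHom) = MonoidHom.id _ := rfl
    rw [this, Subgroup.map_id]
  mul_mem' := by
    intro x y hx hy
    obtain ⟨hx1, ⟨gx, hgx, hgxv⟩, ⟨kx, hkx, hkxa⟩⟩ := hx
    obtain ⟨hy1, ⟨gy, hgy, hgyv⟩, ⟨ky, hky, hkya⟩⟩ := hy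
    have hmap : ((x * y : MulAut (Sapphire r s t u)).toMonoidHom)
        = x.toMonoidHom.comp y.toMonoidHom := rfl
    refine ⟨by rw [hmap, ← Subgroup.map_map, hy1, hx1],
      ⟨x gy * gx, mul_mem (mem_of_map_eq hx1 hgy) hgx, ?_⟩,
      ⟨x ky * kx, mul_mem (mem_of_map_eq hx1 hky) hkx, ?_⟩⟩
    · have : (x * y : MulAut (Sapphire r s t u)) (sapv r s t u) = x (y (sapv r s t u)) := rfl
      rw [this, hgyv, _root_.map_mul, hgxv, ← mul_assoc]
    · have : (x * y : MulAut (Sapphire r s t u)) (sapa r s t u) = x (y (sapa r s t u)) := rfl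
      rw [this, hkya, _root_.map_mul, hkxa, ← mul_assoc]
  inv_mem' := by
    intro x hx
    obtain ⟨hx1, ⟨g, hg, hgv⟩, ⟨k, hk, hka⟩⟩ := hx
    refine ⟨map_inv_eq_of_map_eq hx1,
      ⟨((x⁻¹ : MulAut (Sapphire r s t u)) g)⁻¹,
        inv_mem (mem_of_map_eq (map_inv_eq_of_map_eq hx1) hg), ?_⟩,
      ⟨((x⁻¹ : MulAut (Sapphire r s t u)) k)⁻¹,
        inv_mem (mem_of_map_eq (map_inv_eq_of_map_eq hx1) hk), ?_⟩⟩
    · have h1 : (x⁻¹ : MulAut (Sapphire r s t u)) (x (sapv r s t u)) = sapv r s t u := by simp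
      rw [hgv, _root_.map_mul] at h1
      rw [eq_inv_mul_iff_mul_eq, h1]
    · have h1 : (x⁻¹ : MulAut (Sapphire r s t u)) (x (sapa r s t u)) = sapa r s t u := by simp
      rw [hka, _root_.map_mul] at h1
      rw [eq_inv_mul_iff_mul_eq, h1]

/-- The elements `d, b, v, a` of a group satisfy the defining relations of the sapphire group. -/
structure IsSapphire {H : Type*} [Group H] (r s t u : ℤ) (d b v a : H) : Prop where
  comm : d * b = b * d
  conj_d : v * d * v⁻¹ = d ^ (r * u + s * t) * b ^ (-(2 * s * u))
  conj_b : v * b * v⁻¹ = d ^ (-(2 * r * t)) * b ^ (r * u + s * t)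
  sq : a ^ 2 = d
  inv_b : a * b * a⁻¹ = b⁻¹
  conj_v : a * v * a⁻¹ = d ^ (r - r * u - s * t) * b ^ (s - 2 * s * u) * v⁻¹

namespace IsSapphire

section Relations

variable {H : Type*} [Group H] {r s t u : ℤ} {d b v a : H}

lemma mul_mul (h : IsSapphire r s t u d b v a) (i j k l : ℤ) :
    d ^ i * b ^ j * (d ^ k * b ^ l) = d ^ (i + k) * b ^ (j + l) := by
  have hc : Commute (d ^ k) (b ^ j) := Commute.zpow_zpow h.comm k j
  rw [_root_.zpow_add, _root_.zpow_add, mul_assoc, ← mul_assoc (b ^ j), ← hc.eq]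
  simp only [mul_assoc]

lemma mul_inv (h : IsSapphire r s t u d b v a) (i j : ℤ) :
    (d ^ i * b ^ j)⁻¹ = d ^ (-i) * b ^ (-j) := by
  rw [inv_eq_iff_mul_eq_one, h.mul_mul]
  simp

lemma mul_zpow (h : IsSapphire r s t u d b v a) (i j n : ℤ) :
    (d ^ i * b ^ j) ^ n = d ^ (i * n) * b ^ (j * n) := by
  have hc : Commute (d ^ i) (b ^ j) := Commute.zpow_zpow h.comm i j
  rw [hc.mul_zpow, ← _root_.zpow_mul, ← _root_.zpow_mul]

lemma v_mul (h : IsSapphire r s t u d b v a) (i j : ℤ) :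
    v * (d ^ i * b ^ j) =
      d ^ ((r * u + s * t) * i - 2 * r * t * j) * b ^ (-(2 * s * u) * i + (r * u + s * t) * j)
        * v := by
  rw [← mul_inv_eq_iff_eq_mul]
  have e : v * (d ^ i * b ^ j) * v⁻¹ = (v * d * v⁻¹) ^ i * (v * b * v⁻¹) ^ j := by
    rw [conj_zpow, conj_zpow]; group
  rw [e, h.conj_d, h.conj_b, h.mul_zpow, h.mul_zpow, h.mul_mul]
  congr 2; ring

lemma v_inv_mul (h : IsSapphire r s t u d b v a) (h1 : r * u - s * t = 1) (i j : ℤ) :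
    v⁻¹ * (d ^ i * b ^ j) =
      d ^ ((r * u + s * t) * i + 2 * r * t * j) * b ^ (2 * s * u * i + (r * u + s * t) * j)
        * v⁻¹ := by
  rw [inv_mul_eq_iff_eq_mul, ← mul_assoc, h.v_mul, mul_inv_cancel_right]
  congr 2
  · linear_combination (-i * (r * u - s * t + 1)) * h1
  · linear_combination (-j * (r * u - s * t + 1)) * h1

lemma a_mul (h : IsSapphire r s t u d b v a) (i j : ℤ) :
    a * (d ^ i * b ^ j) = d ^ i * b ^ (-j) * a := by
  rw [← mul_inv_eq_iff_eq_mul]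
  have e : a * (d ^ i * b ^ j) * a⁻¹ = (a * d * a⁻¹) ^ i * (a * b * a⁻¹) ^ j := by
    rw [conj_zpow, conj_zpow]; group
  rw [e, h.inv_b, _root_.inv_zpow', ← h.sq]
  group

lemma zpow_mul_v_mul (h : IsSapphire r s t u d b v a) (k l i j : ℤ) :
    d ^ k * b ^ l * v * (d ^ i * b ^ j) =
      d ^ ((r * u + s * t) * i - 2 * r * t * j) * b ^ (-(2 * s * u) * i + (r * u + s * t) * j) *
        (d ^ k * b ^ l * v) := by
  rw [mul_assoc, h.v_mul, ← mul_assoc, h.mul_mul, ← mul_assoc, h.mul_mul, add_comm, add_comm l]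

lemma zpow_mul_a_mul (h : IsSapphire r s t u d b v a) (k l i j : ℤ) :
    d ^ k * b ^ l * a * (d ^ i * b ^ j) = d ^ i * b ^ (-j) * (d ^ k * b ^ l * a) := by
  rw [mul_assoc, h.a_mul, ← mul_assoc, h.mul_mul, ← mul_assoc, h.mul_mul, add_comm, add_comm l]

lemma mul_a_sq (h : IsSapphire r s t u d b v a) (k l : ℤ) :
    (d ^ k * b ^ l * a) ^ 2 = d ^ (2 * k + 1) * b ^ (0 : ℤ) := by
  rw [pow_two, mul_assoc, ← mul_assoc a, h.a_mul, mul_assoc _ a a, ← pow_two, h.sq, ← mul_assoc,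
    h.mul_mul]
  have e := h.mul_mul (k + k) (l + -l) 1 0
  rw [zpow_one, zpow_zero, mul_one] at e
  rw [e]
  congr 2 <;> ring

lemma conj_v_lhs (h : IsSapphire r s t u d b v a) (k l p q : ℤ) :
    d ^ k * b ^ l * a * (d ^ p * b ^ q * v) =
      d ^ (k + p + (r - r * u - s * t)) * b ^ (l - q + (s - 2 * s * u)) * (v⁻¹ * a) := by
  have e := mul_inv_eq_iff_eq_mul.1 h.conj_v
  calc _ = d ^ k * b ^ l * (a * (d ^ p * b ^ q)) * v := by simp only [mul_assoc]
    _ = d ^ k * b ^ l * (d ^ p * b ^ (-q)) * (a * v) := by rw [h.a_mul]; simp only [mul_assoc]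
    _ = d ^ k * b ^ l * (d ^ p * b ^ (-q)) *
          (d ^ (r - r * u - s * t) * b ^ (s - 2 * s * u)) * (v⁻¹ * a) := by
        rw [e]; simp only [mul_assoc]
    _ = _ := by rw [h.mul_mul, h.mul_mul, ← sub_eq_add_neg]

lemma conj_v_rhs (h : IsSapphire r s t u d b v a) (h1 : r * u - s * t = 1) (k l p q i j : ℤ) :
    d ^ i * b ^ j * (d ^ p * b ^ q * v)⁻¹ * (d ^ k * b ^ l * a) =
      d ^ (i + ((r * u + s * t) * (k - p) + 2 * r * t * (l - q))) *
        b ^ (j + (2 * s * u * (k - p) + (r * u + s * t) * (l - q))) * (v⁻¹ * a) := by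
  calc _ = d ^ i * b ^ j * (v⁻¹ * ((d ^ p * b ^ q)⁻¹ * (d ^ k * b ^ l))) * a := by
        rw [_root_.mul_inv_rev]; simp only [mul_assoc]
    _ = d ^ i * b ^ j * (d ^ ((r * u + s * t) * (-p + k) + 2 * r * t * (-q + l)) *
          b ^ (2 * s * u * (-p + k) + (r * u + s * t) * (-q + l))) * (v⁻¹ * a) := by
        rw [h.mul_inv, h.mul_mul, h.v_inv_mul h1]; simp only [mul_assoc]
    _ = _ := by rw [h.mul_mul, neg_add_eq_sub, neg_add_eq_sub]

/-- Quadruples `d ^ e, b ^ e, g * v, k * a` with `g, k ∈ ⟨d, b⟩` again satisfy the sapphire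
relations, where `e = 1 - 2 * c`. -/
lemma twist (h : IsSapphire r s t u d b v a) (h1 : r * u - s * t = 1) (c l m : ℤ) :
    IsSapphire r s t u (d ^ (1 - 2 * c)) (b ^ (1 - 2 * c))
      (d ^ (c * (1 - r) + t * m) * b ^ (l + c * s - u * m) * v) (d ^ (-c) * b ^ l * a) := by
  have hd (i j : ℤ) : (d ^ (1 - 2 * c)) ^ i * (b ^ (1 - 2 * c)) ^ j =
      d ^ ((1 - 2 * c) * i) * b ^ ((1 - 2 * c) * j) := by rw [← _root_.zpow_mul, ← _root_.zpow_mul]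
  refine ⟨Commute.zpow_zpow h.comm _ _, ?_, ?_, ?_, ?_, ?_⟩
  · have := h.zpow_mul_v_mul (c * (1 - r) + t * m) (l + c * s - u * m) (1 - 2 * c) 0
    rw [zpow_zero, mul_one] at this
    rw [mul_inv_eq_iff_eq_mul, hd, this]
    congr 3 <;> ring
  · have := h.zpow_mul_v_mul (c * (1 - r) + t * m) (l + c * s - u * m) 0 (1 - 2 * c)
    rw [zpow_zero, one_mul] at this
    rw [mul_inv_eq_iff_eq_mul, hd, this]
    congr 3 <;> ring
  · rw [h.mul_a_sq, zpow_zero, mul_one]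
    congr 1; ring
  · have := h.zpow_mul_a_mul (-c) l 0 (1 - 2 * c)
    rw [zpow_zero, one_mul, one_mul] at this
    rw [mul_inv_eq_iff_eq_mul, this, _root_.zpow_neg]
  · rw [mul_inv_eq_iff_eq_mul, h.conj_v_lhs, hd, h.conj_v_rhs h1]
    congr 3
    · linear_combination (-c * r - t * m) * h1
    · linear_combination (-c * s - u * m) * h1

lemma map {K F : Type*} [Group K] [FunLike F H K] [MonoidHomClass F H K]
    (h : IsSapphire r s t u d b v a) (f : F) :
    IsSapphire r s t u (f d) (f b) (f v) (f a) := by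
  constructor
  · rw [← map_mul, h.comm, map_mul]
  · simpa using congrArg f h.conj_d
  · simpa using congrArg f h.conj_b
  · simpa using congrArg f h.sq
  · simpa using congrArg f h.inv_b
  · simpa using congrArg f h.conj_v

/-- The homomorphism out of the sapphire group determined by a quadruple satisfying its
relations. -/
def lift (h : IsSapphire r s t u d b v a) : Sapphire r s t u →* H :=
  PresentedGroup.toGroup (f := ![d, b, v, a]) (by
    have h₁ := h.comm
    have h₂ := h.conj_d
    have h₃ := h.conj_b
    have h₄ := h.sq
    have h₅ := h.inv_b
    have h₆ := h.conj_v
    rintro x (rfl | rfl | rfl | rfl | rfl | rfl) <;>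
      simp only [_root_.map_mul, map_inv, map_zpow, map_pow, FreeGroup.lift_apply_of, cons_val]
    · rw [h₁]; group
    · rw [h₂, mul_inv_cancel]
    · rw [h₃, mul_inv_cancel]
    · rw [h₄, mul_inv_cancel]
    · rw [h₅, inv_mul_cancel]
    · rw [h₆, mul_inv_cancel])

@[simp] lemma lift_d (h : IsSapphire r s t u d b v a) : h.lift (sapd r s t u) = d :=
  PresentedGroup.toGroup.of _

@[simp] lemma lift_b (h : IsSapphire r s t u d b v a) : h.lift (sapb r s t u) = b :=
  PresentedGroup.toGroup.of _

@[simp] lemma lift_v (h : IsSapphire r s t u d b v a) : h.lift (sapv r s t u) = v :=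
  PresentedGroup.toGroup.of _

@[simp] lemma lift_a (h : IsSapphire r s t u d b v a) : h.lift (sapa r s t u) = a :=
  PresentedGroup.toGroup.of _

end Relations

end IsSapphire

lemma isSapphire_generators (r s t u : ℤ) :
    IsSapphire r s t u (sapd r s t u) (sapb r s t u) (sapv r s t u) (sapa r s t u) := by
  have key : ∀ x ∈ sapphireRels r s t u, PresentedGroup.mk (sapphireRels r s t u) x = 1 :=
    fun x hx => PresentedGroup.one_of_mem hx
  constructor
  · have := key _ (Or.inl rfl)
    simp only [_root_.map_mul, map_inv] at this
    rw [mul_inv_eq_one, mul_inv_eq_iff_eq_mul] at this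
    exact this
  · have := key _ (Or.inr (Or.inl rfl))
    simp only [_root_.map_mul, map_inv, map_zpow] at this
    exact mul_inv_eq_one.1 this
  · have := key _ (Or.inr (Or.inr (Or.inl rfl)))
    simp only [_root_.map_mul, map_inv, map_zpow] at this
    exact mul_inv_eq_one.1 this
  · have := key _ (Or.inr (Or.inr (Or.inr (Or.inl rfl))))
    simp only [_root_.map_mul, map_inv, map_pow] at this
    exact mul_inv_eq_one.1 this
  · have := key _ (Or.inr (Or.inr (Or.inr (Or.inr (Or.inl rfl)))))
    simp only [_root_.map_mul, map_inv] at this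
    exact mul_eq_one_iff_eq_inv.1 this
  · have := key _ (Or.inr (Or.inr (Or.inr (Or.inr (Or.inr rfl)))))
    simp only [_root_.map_mul, map_inv, map_zpow] at this
    exact mul_inv_eq_one.1 this

lemma sapphire_hom_ext {r s t u : ℤ} {H : Type*} [Group H] {f g : Sapphire r s t u →* H}
    (hd : f (sapd r s t u) = g (sapd r s t u)) (hb : f (sapb r s t u) = g (sapb r s t u))
    (hv : f (sapv r s t u) = g (sapv r s t u)) (ha : f (sapa r s t u) = g (sapa r s t u)) :
    f = g :=
  PresentedGroup.ext fun x => by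
    fin_cases x
    exacts [hd, hb, hv, ha]

lemma mem_sapDB_iff {r s t u : ℤ} {g : Sapphire r s t u} :
    g ∈ sapDB r s t u ↔ ∃ i j : ℤ, g = sapd r s t u ^ i * sapb r s t u ^ j := by
  have h := isSapphire_generators r s t u
  constructor
  · intro hg
    induction hg using Subgroup.closure_induction with
    | mem x hx =>
      rcases hx with rfl | rfl
      · exact ⟨1, 0, by simp⟩
      · exact ⟨0, 1, by simp⟩
    | one => exact ⟨0, 0, by simp⟩
    | mul x y _ _ hx hy =>
      obtain ⟨i, j, rfl⟩ := hx
      obtain ⟨k, l, rfl⟩ := hy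
      exact ⟨_, _, h.mul_mul i j k l⟩
    | inv x _ hx =>
      obtain ⟨i, j, rfl⟩ := hx
      exact ⟨_, _, h.mul_inv i j⟩
  · rintro ⟨i, j, rfl⟩
    exact mul_mem (zpow_mem (Subgroup.subset_closure (by simp)) i)
      (zpow_mem (Subgroup.subset_closure (by simp)) j)

/-- The affine permutation of `ℤ × ℤ` by which the generator `v` acts. -/
def sapphireAffineV (r s t u : ℤ) (h1 : r * u - s * t = 1) : Equiv.Perm (ℤ × ℤ) where
  toFun p := ((r * u + s * t) * p.1 - 2 * r * t * p.2 + (r - 1),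
    -(2 * s * u) * p.1 + (r * u + s * t) * p.2 - s)
  invFun p := ((r * u + s * t) * (p.1 - (r - 1)) + 2 * r * t * (p.2 + s),
    2 * s * u * (p.1 - (r - 1)) + (r * u + s * t) * (p.2 + s))
  left_inv p := by
    ext
    · linear_combination (p.1 * (r * u - s * t + 1)) * h1
    · linear_combination (p.2 * (r * u - s * t + 1)) * h1
  right_inv p := by
    ext
    · linear_combination ((p.1 - (r - 1)) * (r * u - s * t + 1)) * h1
    · linear_combination ((p.2 + s) * (r * u - s * t + 1)) * h1

/-- The affine permutation of `ℤ × ℤ` by which the generator `a` acts. -/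
def sapphireAffineA : Equiv.Perm (ℤ × ℤ) where
  toFun p := (p.1 + 1, -p.2)
  invFun p := (p.1 - 1, -p.2)
  left_inv p := by simp
  right_inv p := by simp

/-- The sapphire group acts by affine maps on `ℤ × ℤ`, with `d` and `b` acting as translations. -/
lemma isSapphire_affine {r s t u : ℤ} (h1 : r * u - s * t = 1) :
    IsSapphire r s t u (Equiv.addRight ((2, 0) : ℤ × ℤ)) (Equiv.addRight ((0, 2) : ℤ × ℤ))
      (sapphireAffineV r s t u h1) sapphireAffineA := by
  constructor
  · ext p <;> simp
  · rw [mul_inv_eq_iff_eq_mul, Equiv.zsmul_addRight, Equiv.zsmul_addRight]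
    ext p <;> (simp [sapphireAffineV]; ring)
  · rw [mul_inv_eq_iff_eq_mul, Equiv.zsmul_addRight, Equiv.zsmul_addRight]
    ext p <;> (simp [sapphireAffineV]; ring)
  · ext p
    · simp [sapphireAffineA, pow_two]
      ring
    · simp [sapphireAffineA, pow_two]
  · rw [mul_inv_eq_iff_eq_mul]
    ext p
    · simp [sapphireAffineA]
    · simp [sapphireAffineA]
      ring
  · rw [mul_inv_eq_iff_eq_mul, Equiv.zsmul_addRight, Equiv.zsmul_addRight]
    ext p
    · simp [sapphireAffineA, sapphireAffineV, Equiv.Perm.inv_def]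
      linear_combination r * h1
    · simp [sapphireAffineA, sapphireAffineV, Equiv.Perm.inv_def]
      linear_combination s * h1

/-- The subgroup `⟨d, b⟩` is free abelian on `d` and `b`. -/
lemma sapDB_zpow_inj {r s t u : ℤ} (h1 : r * u - s * t = 1) {i j k l : ℤ} :
    sapd r s t u ^ i * sapb r s t u ^ j = sapd r s t u ^ k * sapb r s t u ^ l ↔
      i = k ∧ j = l := by
  refine ⟨fun h => ?_, by rintro ⟨rfl, rfl⟩; rfl⟩
  have e := congrArg (fun x => (isSapphire_affine h1).lift x ((0, 0) : ℤ × ℤ)) h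
  simp only [_root_.map_mul, map_zpow, IsSapphire.lift_d, IsSapphire.lift_b,
    Equiv.zsmul_addRight] at e
  simpa using e

/-- The nontrivial homomorphism from `ℤ/2` to `{1, -1}`. -/
def zmodTwoSign : Multiplicative (ZMod 2) →* ℤˣ where
  toFun z := if z = 1 then 1 else -1
  map_one' := rfl
  map_mul' := by decide

/-- The units of `ℤ` acting on a commutative group by powers. -/
def unitsZPowAut (A : Type*) [CommGroup A] : ℤˣ →* MulAut A where
  toFun e :=
    { toFun := fun x => x ^ (e : ℤ)
      invFun := fun x => x ^ (e : ℤ)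
      left_inv := fun x => by
        simp only [← _root_.zpow_mul, Int.units_coe_mul_self, zpow_one]
      right_inv := fun x => by
        simp only [← _root_.zpow_mul, Int.units_coe_mul_self, zpow_one]
      map_mul' := fun x y => _root_.mul_zpow x y _ }
  map_one' := by ext x; exact zpow_one x
  map_mul' e f := by
    ext x
    change x ^ ((e * f : ℤˣ) : ℤ) = (x ^ (f : ℤ)) ^ (e : ℤ)
    rw [← _root_.zpow_mul, mul_comm e f, Units.val_mul]

/-- The action of `ℤ/2` on `ℤ × ℤ` by multiplication by `-1`. -/
def negAction : Multiplicative (ZMod 2) →* MulAut (Multiplicative (ℤ × ℤ)) :=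
  (unitsZPowAut (Multiplicative (ℤ × ℤ))).comp zmodTwoSign

lemma negAction_apply (z : Multiplicative (ZMod 2)) (x : Multiplicative (ℤ × ℤ)) :
    negAction z x = x ^ (zmodTwoSign z : ℤ) := rfl

/-- The representative in `{0, 1}` of an element of `ℤ/2`. -/
def zmodTwoRep (z : Multiplicative (ZMod 2)) : ℤ := if z = 1 then 0 else 1

lemma coe_zmodTwoSign : ∀ z, (zmodTwoSign z : ℤ) = 1 - 2 * zmodTwoRep z := by decide

lemma zmodTwoRep_mul : ∀ z w,
    zmodTwoRep (z * w) = zmodTwoRep z + (1 - 2 * zmodTwoRep z) * zmodTwoRep w := by decide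

lemma zmodTwoRep_injective : Function.Injective zmodTwoRep := by
  unfold Function.Injective
  decide

section Twist

variable {r s t u : ℤ}

/-- The endomorphism of the sapphire group with `d ↦ d ^ (1 - 2 * c)`, `b ↦ b ^ (1 - 2 * c)`, and
multiplying `v` and `a` on the left by elements of `⟨d, b⟩` depending on `c`, `l` and `m`. -/
def sapphireTwist (h1 : r * u - s * t = 1) (c l m : ℤ) : Sapphire r s t u →* Sapphire r s t u :=
  ((isSapphire_generators r s t u).twist h1 c l m).lift

lemma sapphireTwist_zpow (h1 : r * u - s * t = 1) (c l m i j : ℤ) :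
    sapphireTwist h1 c l m (sapd r s t u ^ i * sapb r s t u ^ j) =
      sapd r s t u ^ ((1 - 2 * c) * i) * sapb r s t u ^ ((1 - 2 * c) * j) := by
  simp only [sapphireTwist, _root_.map_mul, map_zpow, IsSapphire.lift_d, IsSapphire.lift_b,
    ← _root_.zpow_mul]

lemma sapphireTwist_v (h1 : r * u - s * t = 1) (c l m : ℤ) :
    sapphireTwist h1 c l m (sapv r s t u) =
      sapd r s t u ^ (c * (1 - r) + t * m) * sapb r s t u ^ (l + c * s - u * m) * sapv r s t u :=
  IsSapphire.lift_v _

lemma sapphireTwist_a (h1 : r * u - s * t = 1) (c l m : ℤ) :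
    sapphireTwist h1 c l m (sapa r s t u) =
      sapd r s t u ^ (-c) * sapb r s t u ^ l * sapa r s t u :=
  IsSapphire.lift_a _

lemma sapphireTwist_comp (h1 : r * u - s * t = 1) (c l m c' l' m' : ℤ) :
    (sapphireTwist h1 c l m).comp (sapphireTwist h1 c' l' m') =
      sapphireTwist h1 (c + (1 - 2 * c) * c') (l + (1 - 2 * c) * l') (m + (1 - 2 * c) * m') := by
  have h := isSapphire_generators r s t u
  apply sapphire_hom_ext
  · simp only [MonoidHom.comp_apply, sapphireTwist, IsSapphire.lift_d, map_zpow,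
      ← _root_.zpow_mul]
    congr 1; ring
  · simp only [MonoidHom.comp_apply, sapphireTwist, IsSapphire.lift_b, map_zpow,
      ← _root_.zpow_mul]
    congr 1; ring
  · rw [MonoidHom.comp_apply, sapphireTwist_v, _root_.map_mul, sapphireTwist_v,
      sapphireTwist_zpow, sapphireTwist_v, ← mul_assoc, h.mul_mul]
    congr 3 <;> ring
  · rw [MonoidHom.comp_apply, sapphireTwist_a, _root_.map_mul, sapphireTwist_a,
      sapphireTwist_zpow, sapphireTwist_a, ← mul_assoc, h.mul_mul]
    congr 3 <;> ring

lemma sapphireTwist_zero (h1 : r * u - s * t = 1) :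
    sapphireTwist h1 0 0 0 = MonoidHom.id _ := by
  apply sapphire_hom_ext
  · simp [sapphireTwist]
  · simp [sapphireTwist]
  · simp [sapphireTwist_v]
  · simp [sapphireTwist_a]

/-- The endomorphism `sapphireTwist` with parameters in `(ℤ × ℤ) ⋊ ℤ/2`. -/
def sapphireTwistEnd (h1 : r * u - s * t = 1) :
    (Multiplicative (ℤ × ℤ) ⋊[negAction] Multiplicative (ZMod 2)) →*
      Monoid.End (Sapphire r s t u) where
  toFun p := sapphireTwist h1 (zmodTwoRep p.right) (toAdd p.left).1 (toAdd p.left).2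
  map_one' := sapphireTwist_zero h1
  map_mul' p q := by
    refine Eq.trans ?_ (sapphireTwist_comp h1 _ _ _ _ _ _).symm
    rw [mul_right, mul_left, zmodTwoRep_mul, negAction_apply, coe_zmodTwoSign]
    simp only [toAdd_mul, toAdd_zpow, Prod.fst_add, Prod.snd_add, Prod.smul_fst, Prod.smul_snd,
      smul_eq_mul]
    rfl

/-- The automorphism `sapphireTwist` with parameters in `(ℤ × ℤ) ⋊ ℤ/2`. -/
def sapphireTwistAut (h1 : r * u - s * t = 1) :
    (Multiplicative (ℤ × ℤ) ⋊[negAction] Multiplicative (ZMod 2)) →*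
      MulAut (Sapphire r s t u) where
  toFun p := MonoidHom.toMulEquiv (sapphireTwistEnd h1 p) (sapphireTwistEnd h1 p⁻¹)
    (by
      change sapphireTwistEnd h1 p⁻¹ * sapphireTwistEnd h1 p = 1
      rw [← _root_.map_mul, inv_mul_cancel, _root_.map_one])
    (by
      change sapphireTwistEnd h1 p * sapphireTwistEnd h1 p⁻¹ = 1
      rw [← _root_.map_mul, mul_inv_cancel, _root_.map_one])
  map_one' := MulEquiv.ext fun x => DFunLike.congr_fun (_root_.map_one (sapphireTwistEnd h1)) x
  map_mul' p q :=
    MulEquiv.ext fun x => DFunLike.congr_fun (_root_.map_mul (sapphireTwistEnd h1) p q) x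

lemma sapphireTwistAut_apply (h1 : r * u - s * t = 1)
    (p : Multiplicative (ℤ × ℤ) ⋊[negAction] Multiplicative (ZMod 2)) (x : Sapphire r s t u) :
    sapphireTwistAut h1 p x =
      sapphireTwist h1 (zmodTwoRep p.right) (toAdd p.left).1 (toAdd p.left).2 x := rfl

lemma sapphireTwistAut_mem_sapDB (h1 : r * u - s * t = 1)
    (p : Multiplicative (ℤ × ℤ) ⋊[negAction] Multiplicative (ZMod 2)) {x : Sapphire r s t u}
    (hx : x ∈ sapDB r s t u) : sapphireTwistAut h1 p x ∈ sapDB r s t u := by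
  obtain ⟨i, j, rfl⟩ := mem_sapDB_iff.1 hx
  rw [sapphireTwistAut_apply, sapphireTwist_zpow]
  exact mem_sapDB_iff.2 ⟨_, _, rfl⟩

lemma sapphireTwistAut_mem (h1 : r * u - s * t = 1)
    (p : Multiplicative (ℤ × ℤ) ⋊[negAction] Multiplicative (ZMod 2)) :
    sapphireTwistAut h1 p ∈ sapAut₀₀ r s t u := by
  refine ⟨le_antisymm ?_ fun x hx => ?_,
    ⟨_, ?_, sapphireTwist_v h1 (zmodTwoRep p.right) (toAdd p.left).1 (toAdd p.left).2⟩,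
    ⟨_, ?_, sapphireTwist_a h1 (zmodTwoRep p.right) (toAdd p.left).1 (toAdd p.left).2⟩⟩
  · rintro _ ⟨x, hx, rfl⟩
    exact sapphireTwistAut_mem_sapDB h1 p hx
  · refine ⟨_, sapphireTwistAut_mem_sapDB h1 p⁻¹ hx, ?_⟩
    change (sapphireTwistAut h1 p * sapphireTwistAut h1 p⁻¹) x = x
    rw [← _root_.map_mul, mul_inv_cancel, _root_.map_one, MulAut.one_apply]
  · exact mem_sapDB_iff.2 ⟨_, _, rfl⟩
  · exact mem_sapDB_iff.2 ⟨_, _, rfl⟩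

lemma sapphireTwistAut_injective (h1 : r * u - s * t = 1) (ht : t ≠ 0) :
    Function.Injective (sapphireTwistAut (r := r) (s := s) (t := t) (u := u) h1) := by
  intro p q hpq
  have ha := DFunLike.congr_fun hpq (sapa r s t u)
  have hv := DFunLike.congr_fun hpq (sapv r s t u)
  rw [sapphireTwistAut_apply, sapphireTwistAut_apply] at ha hv
  rw [sapphireTwist_a, sapphireTwist_a, mul_left_inj, sapDB_zpow_inj h1, neg_inj] at ha
  rw [sapphireTwist_v, sapphireTwist_v, mul_left_inj, sapDB_zpow_inj h1, ha.1,
    add_right_inj, mul_right_inj' ht] at hv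
  exact SemidirectProduct.ext (toAdd.injective (Prod.ext ha.2 hv.1)) (zmodTwoRep_injective ha.1)

/-- An automorphism in `Aut₀⁰(E)` restricts to `⟨d, b⟩` as multiplication by an odd number. -/
lemma map_zpow_of_mem_sapAut₀₀ (h1 : r * u - s * t = 1) (hs : s ≠ 0) (hu : u ≠ 0)
    {φ : MulAut (Sapphire r s t u)} (hφ : φ ∈ sapAut₀₀ r s t u) {k l : ℤ}
    (ha : φ (sapa r s t u) = sapd r s t u ^ k * sapb r s t u ^ l * sapa r s t u) (i j : ℤ) :
    φ (sapd r s t u ^ i * sapb r s t u ^ j) =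
      sapd r s t u ^ ((2 * k + 1) * i) * sapb r s t u ^ ((2 * k + 1) * j) := by
  obtain ⟨hN, ⟨_, hg, hv⟩, -⟩ := hφ
  obtain ⟨x, y, rfl⟩ := mem_sapDB_iff.1 hg
  have h := isSapphire_generators r s t u
  have hφ := h.map φ
  obtain ⟨p, q, hb⟩ := mem_sapDB_iff.1
    (mem_of_map_eq hN (Subgroup.subset_closure (by simp) : sapb r s t u ∈ sapDB r s t u))
  have hd : φ (sapd r s t u) = sapd r s t u ^ (2 * k + 1) * sapb r s t u ^ (0 : ℤ) := by
    rw [← hφ.sq, ha, h.mul_a_sq]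
  have hp : p = 0 := by
    have e := hφ.inv_b
    rw [mul_inv_eq_iff_eq_mul, ha, hb, h.zpow_mul_a_mul, mul_left_inj, h.mul_inv,
      sapDB_zpow_inj h1] at e
    omega
  have hq : q = 2 * k + 1 := by
    have e := hφ.conj_d
    rw [mul_inv_eq_iff_eq_mul, hv, hb, hd, h.zpow_mul_v_mul, mul_left_inj, h.mul_zpow,
      h.mul_zpow, h.mul_mul, sapDB_zpow_inj h1] at e
    exact mul_left_cancel₀ (mul_ne_zero hs hu) (by linarith [e.2])
  rw [_root_.map_mul, map_zpow, map_zpow, hd, hb, h.mul_zpow, h.mul_zpow, h.mul_mul, hp, hq]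
  simp

lemma exists_sapphireTwistAut_eq (h1 : r * u - s * t = 1) (hr : r ≠ 0) (hs : s ≠ 0) (hu : u ≠ 0)
    {φ : MulAut (Sapphire r s t u)} (hφ : φ ∈ sapAut₀₀ r s t u) :
    ∃ p, sapphireTwistAut h1 p = φ := by
  obtain ⟨hN, ⟨_, hg, hv⟩, ⟨_, hk, ha⟩⟩ := id hφ
  obtain ⟨x, y, rfl⟩ := mem_sapDB_iff.1 hg
  obtain ⟨k, l, rfl⟩ := mem_sapDB_iff.1 hk
  have h := isSapphire_generators r s t u
  have hz := map_zpow_of_mem_sapAut₀₀ h1 hs hu hφ ha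
  have hc : ∃ z, zmodTwoRep z = -k := by
    have hd : sapd r s t u ∈ (sapDB r s t u).map φ.toMonoidHom := by
      rw [hN]; exact Subgroup.subset_closure (by simp)
    obtain ⟨w, hw, e⟩ := hd
    obtain ⟨i, j, rfl⟩ := mem_sapDB_iff.1 hw
    have e' := (hz i j).symm.trans (e.trans (by simp : _ = sapd r s t u ^ (1 : ℤ) *
      sapb r s t u ^ (0 : ℤ)))
    rcases Int.eq_one_or_neg_one_of_mul_eq_one ((sapDB_zpow_inj h1).1 e').1 with e₁ | e₁
    · exact ⟨1, by rw [show k = 0 by omega]; rfl⟩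
    · exact ⟨ofAdd 1, by rw [show k = -1 by omega]; rfl⟩
  obtain ⟨z, hzk⟩ := hc
  have e := (h.map φ).conj_v
  have hw := hz (r - r * u - s * t) (s - 2 * s * u)
  rw [_root_.map_mul, map_zpow, map_zpow] at hw
  rw [mul_inv_eq_iff_eq_mul, ha, hv, h.conj_v_lhs, hw, h.conj_v_rhs h1, mul_left_inj,
    sapDB_zpow_inj h1] at e
  have hxy : u * x + t * (y - l) = -k * (u - 1) :=
    mul_left_cancel₀ (mul_ne_zero two_ne_zero hr) (by
      linear_combination e.1 + (x + k) * h1)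
  obtain ⟨m, hm⟩ : ∃ m, m = -s * (x + k * (1 - r)) - r * (y - l + k * s) := ⟨_, rfl⟩
  have hN' (i j : ℤ) : sapphireTwist h1 (-k) l m (sapd r s t u ^ i * sapb r s t u ^ j) =
      φ (sapd r s t u ^ i * sapb r s t u ^ j) := by
    rw [sapphireTwist_zpow, hz]
    congr 2 <;> ring
  refine ⟨⟨ofAdd (l, m), z⟩, MulEquiv.toMonoidHom_injective ?_⟩
  change sapphireTwist h1 (zmodTwoRep z) l m = φ.toMonoidHom
  rw [hzk]
  refine sapphire_hom_ext ?_ ?_ ?_ ?_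
  · simpa using hN' 1 0
  · simpa using hN' 0 1
  · refine (sapphireTwist_v h1 _ _ _).trans (Eq.trans ?_ hv.symm)
    congr 3
    · linear_combination t * hm + (x + k) * h1 - r * hxy
    · linear_combination -u * hm + (y - l) * h1 + s * hxy
  · refine (sapphireTwist_a h1 _ _ _).trans (Eq.trans ?_ ha.symm)
    rw [neg_neg]

/-- `Aut₀⁰(E)` is the semidirect product `(ℤ × ℤ) ⋊ ℤ/2`. -/
noncomputable def sapAut₀₀Equiv (h1 : r * u - s * t = 1) (hr : r ≠ 0) (hs : s ≠ 0) (ht : t ≠ 0)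
    (hu : u ≠ 0) :
    (Multiplicative (ℤ × ℤ) ⋊[negAction] Multiplicative (ZMod 2)) ≃* sapAut₀₀ r s t u :=
  MulEquiv.ofBijective ((sapphireTwistAut h1).codRestrict _ (sapphireTwistAut_mem h1))
    ⟨fun _ _ hpq => sapphireTwistAut_injective h1 ht (congrArg Subtype.val hpq),
      fun φ => (exists_sapphireTwistAut_eq h1 hr hs hu φ.2).imp fun _ hp => Subtype.ext hp⟩

end Twist

/-- `Aut₀⁰(E)` sits in a split short exact sequence
`0 → ℤ × ℤ → Aut₀⁰(E) → ℤ/2 → 0`, and is isomorphic to `(ℤ × ℤ) ⋊ ℤ/2`, where the nontrivial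
element of `ℤ/2` acts by multiplication by `-1`. -/
theorem stmt12 (r s t u : ℤ) (h1 : r * u - s * t = 1) (h0 : r * s * t * u ≠ 0) :
    (∃ (ι : Multiplicative (ℤ × ℤ) →* sapAut₀₀ r s t u)
        (π : sapAut₀₀ r s t u →* Multiplicative (ZMod 2)),
      Function.Injective ι ∧ Function.Surjective π ∧ π.ker = ι.range ∧
      ∃ σ : Multiplicative (ZMod 2) →* sapAut₀₀ r s t u,
        π.comp σ = MonoidHom.id (Multiplicative (ZMod 2))) ∧
    ∃ ψ : Multiplicative (ZMod 2) →* MulAut (Multiplicative (ℤ × ℤ)),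
      (∀ x : Multiplicative (ℤ × ℤ), ψ (Multiplicative.ofAdd 1) x = x⁻¹) ∧
      Nonempty ((sapAut₀₀ r s t u) ≃*
        (Multiplicative (ℤ × ℤ) ⋊[ψ] Multiplicative (ZMod 2))) := by
  simp only [mul_ne_zero_iff] at h0
  obtain ⟨⟨⟨hr, hs⟩, ht⟩, hu⟩ := h0
  let e := sapAut₀₀Equiv h1 hr hs ht hu
  refine ⟨⟨e.toMonoidHom.comp inl, rightHom.comp e.symm.toMonoidHom, ?_, ?_, ?_,
    e.toMonoidHom.comp inr, ?_⟩, negAction, fun x => zpow_neg_one x, ⟨e.symm⟩⟩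
  · exact e.injective.comp inl_injective
  · exact rightHom_surjective.comp e.symm.surjective
  · rw [MonoidHom.range_comp, range_inl_eq_ker_rightHom]
    ext φ
    exact (Subgroup.mem_map_equiv (f := e) (K := rightHom.ker) (x := φ)).symm
  · ext z
    simp
end
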